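/- arXiv:2211.16722 — 2 statements merged into one kernel-verified Lean document; each statement's English description precedes it below -/
import Mathlib

section
/- With the acoustic geometry setup and Levi-Civita connection D below, define the deformation tensor of L by ^{(L)}π(X,Y) := g(D_X L, Y) + g(D_Y L, X) for vector fields X, Y. Then on U: ^{(L)}π(L,L) = 0, ^{(L)}π(L,T) = −Lμ, ^{(L)}π(L,L̄) = −2Lμ, ^{(L)}π(T,T) = 2c^{−1}μ·L(c^{−1}μ), and ^{(L)}π(L̄,L̄) = 4μ·L(c^{−2}μ). -/
noncomputable section

open scoped BigOperators

/-- Points of ℝ⁴ with coordinates (x⁰,x¹,x²,x³) = (t,x¹,x²,x³). -/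
abbrev Pt : Type := Fin 4 → ℝ

/-- Partial derivative ∂_α f. -/
def pd (f : Pt → ℝ) (α : Fin 4) (x : Pt) : ℝ :=
  fderiv ℝ f x (Pi.single α 1)

/-- The acoustic metric g = diag(−c², 1, 1, 1). -/
def gMat (c : Pt → ℝ) (α β : Fin 4) (x : Pt) : ℝ :=
  if α = β then (if α = 0 then -(c x) ^ 2 else 1) else 0

/-- The inverse metric g⁻¹ = diag(−c⁻², 1, 1, 1). -/
def gInv (c : Pt → ℝ) (α β : Fin 4) (x : Pt) : ℝ :=
  if α = β then (if α = 0 then -((c x) ^ 2)⁻¹ else 1) else 0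

/-- Vf = V^α ∂_α f. -/
def vApp (V : Pt → Fin 4 → ℝ) (f : Pt → ℝ) (x : Pt) : ℝ :=
  ∑ α, V x α * pd f α x

/-- g(V, W) = g_{αβ} V^α W^β. -/
def gPair (c : Pt → ℝ) (V W : Pt → Fin 4 → ℝ) (x : Pt) : ℝ :=
  ∑ α, ∑ β, gMat c α β x * V x α * W x β

/-- L̂^α = −g^{αβ}∂_β u. -/
def Lhat (c u : Pt → ℝ) (x : Pt) (α : Fin 4) : ℝ :=
  -∑ β, gInv c α β x * pd u β x

/-- The inverse foliation density μ = 1/(c⁻²∂_t u). -/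
def invDens (c u : Pt → ℝ) (x : Pt) : ℝ :=
  (((c x) ^ 2)⁻¹ * pd u 0 x)⁻¹

/-- L = μ L̂  (so L⁰ = 1). -/
def Lvec (c u : Pt → ℝ) (x : Pt) (α : Fin 4) : ℝ :=
  invDens c u x * Lhat c u x α

/-- T̂ = c⁻¹(∂_t − L). -/
def That (c u : Pt → ℝ) (x : Pt) (α : Fin 4) : ℝ :=
  (c x)⁻¹ * ((if α = 0 then 1 else 0) - Lvec c u x α)

/-- T = c⁻¹ μ T̂. -/
def Tvec (c u : Pt → ℝ) (x : Pt) (α : Fin 4) : ℝ :=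
  (c x)⁻¹ * invDens c u x * That c u x α

/-- L̄ = c⁻²μ L + 2T. -/
def Lbar (c u : Pt → ℝ) (x : Pt) (α : Fin 4) : ℝ :=
  ((c x) ^ 2)⁻¹ * invDens c u x * Lvec c u x α + 2 * Tvec c u x α

/-- The induced inverse metric ĝ^{αβ} = g^{αβ} + (2μ)⁻¹(L^αL̄^β + L̄^αL^β). -/
def ghat (c u : Pt → ℝ) (α β : Fin 4) (x : Pt) : ℝ :=
  gInv c α β x + (2 * invDens c u x)⁻¹ *
    (Lvec c u x α * Lbar c u x β + Lbar c u x α * Lvec c u x β)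

/-- The Christoffel symbols Γ_{αβγ} = ½(∂_α g_{βγ} + ∂_γ g_{αβ} − ∂_β g_{αγ}). -/
def Gamlow (c : Pt → ℝ) (α β γ : Fin 4) (x : Pt) : ℝ :=
  (1 / 2) * (pd (fun y => gMat c β γ y) α x + pd (fun y => gMat c α β y) γ x
    - pd (fun y => gMat c α γ y) β x)

/-- Γ^γ_{αβ} = g^{γλ} Γ_{αλβ}. -/
def Gam (c : Pt → ℝ) (γ α β : Fin 4) (x : Pt) : ℝ :=
  ∑ l, gInv c γ l x * Gamlow c α l β x

/-- The Levi-Civita covariant derivative: (D_X V)^γ = X^α(∂_α V^γ + Γ^γ_{αβ}V^β). -/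
def covD (c : Pt → ℝ) (X V : Pt → Fin 4 → ℝ) (x : Pt) (γ : Fin 4) : ℝ :=
  ∑ α, X x α * (pd (fun y => V y γ) α x + ∑ β, Gam c γ α β x * V x β)

/-- The deformation tensor of L: ^{(L)}π(X,Y) = g(D_X L, Y) + g(D_Y L, X). -/
def defoL (c u : Pt → ℝ) (X Y : Pt → Fin 4 → ℝ) (x : Pt) : ℝ :=
  gPair c (covD c X (Lvec c u)) Y x + gPair c (covD c Y (Lvec c u)) X x

lemma pd_congr_of_eqOn {f h : Pt → ℝ} {U : Set Pt} (hU : IsOpen U) {x : Pt} (hx : x ∈ U)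
    (hfh : ∀ y ∈ U, f y = h y) (α : Fin 4) : pd f α x = pd h α x := by
  have : f =ᶠ[nhds x] h := Filter.eventually_of_mem (hU.mem_nhds hx) hfh
  simp only [pd, this.fderiv_eq]

lemma pd_const (a : ℝ) (α : Fin 4) (x : Pt) : pd (fun _ => a) α x = 0 := by
  simp [pd]

lemma pd_add {f h : Pt → ℝ} {x : Pt} (hf : DifferentiableAt ℝ f x)
    (hh : DifferentiableAt ℝ h x) (α : Fin 4) :
    pd (fun y => f y + h y) α x = pd f α x + pd h α x := by
  simp [pd, fderiv_fun_add hf hh]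

lemma pd_neg (f : Pt → ℝ) (x : Pt) (α : Fin 4) :
    pd (fun y => -f y) α x = -pd f α x := by
  simp [pd]

lemma pd_mul {f h : Pt → ℝ} {x : Pt} (hf : DifferentiableAt ℝ f x)
    (hh : DifferentiableAt ℝ h x) (α : Fin 4) :
    pd (fun y => f y * h y) α x = f x * pd h α x + h x * pd f α x := by
  simp [pd, fderiv_fun_mul hf hh]

lemma pd_sq {f : Pt → ℝ} {x : Pt} (hf : DifferentiableAt ℝ f x) (α : Fin 4) :
    pd (fun y => f y ^ 2) α x = 2 * f x * pd f α x := by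
  simp only [sq, pd_mul hf hf]
  ring

lemma pd_sum_three_sq {f₁ f₂ f₃ : Pt → ℝ} {x : Pt} (h₁ : DifferentiableAt ℝ f₁ x)
    (h₂ : DifferentiableAt ℝ f₂ x) (h₃ : DifferentiableAt ℝ f₃ x) (α : Fin 4) :
    pd (fun y => f₁ y ^ 2 + f₂ y ^ 2 + f₃ y ^ 2) α x =
      2 * (f₁ x * pd f₁ α x + f₂ x * pd f₂ α x + f₃ x * pd f₃ α x) := by
  have e₁ : DifferentiableAt ℝ (fun y => f₁ y ^ 2) x := h₁.pow 2
  have e₂ : DifferentiableAt ℝ (fun y => f₂ y ^ 2) x := h₂.pow 2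
  have e₃ : DifferentiableAt ℝ (fun y => f₃ y ^ 2) x := h₃.pow 2
  rw [pd_add (e₁.fun_add e₂) e₃, pd_add e₁ e₂, pd_sq h₁, pd_sq h₂, pd_sq h₃]
  ring

lemma pd_inv {f : Pt → ℝ} {x : Pt} (hf : DifferentiableAt ℝ f x) (h0 : f x ≠ 0) (α : Fin 4) :
    pd (fun y => (f y)⁻¹) α x = -pd f α x / f x ^ 2 := by
  have h := (hasDerivAt_inv h0).comp_hasFDerivAt x hf.hasFDerivAt
  have h' : HasFDerivAt (fun y => (f y)⁻¹) (-(f x ^ 2)⁻¹ • fderiv ℝ f x) x := h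
  simp only [pd, h'.fderiv, smul_apply, smul_eq_mul]
  ring

/-- The product rule for a vector field acting on functions. -/
lemma vApp_mul (V : Pt → Fin 4 → ℝ) {f h : Pt → ℝ} {x : Pt} (hf : DifferentiableAt ℝ f x)
    (hh : DifferentiableAt ℝ h x) :
    vApp V (fun y => f y * h y) x = f x * vApp V h x + h x * vApp V f x := by
  simp only [vApp, pd_mul hf hh, Finset.mul_sum, ← Finset.sum_add_distrib]
  exact Finset.sum_congr rfl fun _ _ => by ring

lemma vApp_inv (V : Pt → Fin 4 → ℝ) {f : Pt → ℝ} {x : Pt} (hf : DifferentiableAt ℝ f x)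
    (h0 : f x ≠ 0) : vApp V (fun y => (f y)⁻¹) x = -vApp V f x / f x ^ 2 := by
  simp only [vApp, pd_inv hf h0, neg_div, Finset.sum_div, ← Finset.sum_neg_distrib]
  exact Finset.sum_congr rfl fun _ _ => by ring

lemma vApp_sq (V : Pt → Fin 4 → ℝ) {f : Pt → ℝ} {x : Pt} (hf : DifferentiableAt ℝ f x) :
    vApp V (fun y => f y ^ 2) x = 2 * f x * vApp V f x := by
  simp only [sq, vApp_mul V hf hf]
  ring

lemma pd_pd_comm {u : Pt → ℝ} {x : Pt} (hu : ContDiffAt ℝ 2 u x) (α β : Fin 4) :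
    pd (pd u α) β x = pd (pd u β) α x := by
  have hd : DifferentiableAt ℝ (fderiv ℝ u) x :=
    (hu.fderiv_right (m := 1) (by norm_num)).differentiableAt (by norm_num)
  have key (α β : Fin 4) : pd (pd u α) β x =
      fderiv ℝ (fderiv ℝ u) x (Pi.single β 1) (Pi.single α 1) := by
    have h := hd.hasFDerivAt.clm_apply (hasFDerivAt_const (Pi.single α (1 : ℝ) : Pt) x)
    have h' : HasFDerivAt (pd u α) _ x := h
    rw [pd, h'.fderiv]
    simp
  rw [key, key]
  exact (hu.isSymmSndFDerivAt (by simp)) _ _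

lemma pd_gMat {c : Pt → ℝ} {x : Pt} (hc : DifferentiableAt ℝ c x) (α β γ : Fin 4) :
    pd (fun y => gMat c α β y) γ x =
      if α = β then (if α = 0 then -(2 * c x * pd c γ x) else 0) else 0 := by
  unfold gMat
  split_ifs <;> simp only [pd_const, pd_neg, pd_sq hc]

/-- The deformation tensor as the Lie derivative `ℒ_L g`. -/
lemma defoL_eq {c : Pt → ℝ} (u : Pt → ℝ) {x : Pt} (hc : DifferentiableAt ℝ c x) (h0 : c x ≠ 0)
    (X Y : Pt → Fin 4 → ℝ) :
    defoL c u X Y x = gPair c (fun y γ => vApp X (fun z => Lvec c u z γ) y) Y x +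
      gPair c (fun y γ => vApp Y (fun z => Lvec c u z γ) y) X x -
      2 * c x * vApp (Lvec c u) c x * (X x 0 * Y x 0) := by
  simp only [defoL, gPair, covD, Gam, Gamlow, vApp, pd_gMat hc, Fin.sum_univ_four]
  generalize Lvec c u x = ℓ
  simp [gMat, gInv, Fin.ext_iff]
  field_simp
  ring

section

variable {c u : Pt → ℝ} {x : Pt}

lemma Lvec_zero (h0 : c x ≠ 0) (hp : pd u 0 x ≠ 0) : Lvec c u x 0 = 1 := by
  simp [Lvec, Lhat, invDens, gInv]
  field_simp

lemma Lvec_of_ne_zero {i : Fin 4} (hi : i ≠ 0) :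
    Lvec c u x i = -(invDens c u x * pd u i x) := by
  simp [Lvec, Lhat, gInv, hi]

lemma invDens_mul_pd (hp : pd u 0 x ≠ 0) : invDens c u x * pd u 0 x = c x ^ 2 := by
  simp only [invDens, mul_inv, inv_inv]
  field_simp

lemma pd_zero_sq (h0 : c x ≠ 0)
    (heik : ∑ α, ∑ β, gInv c α β x * pd u α x * pd u β x = 0) :
    pd u 0 x ^ 2 = c x ^ 2 * (pd u 1 x ^ 2 + pd u 2 x ^ 2 + pd u 3 x ^ 2) := by
  simp [gInv, Fin.sum_univ_four] at heik
  field_simp at heik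
  linarith

lemma sum_Lvec_sq (h0 : c x ≠ 0) (hp : pd u 0 x ≠ 0)
    (heik : ∑ α, ∑ β, gInv c α β x * pd u α x * pd u β x = 0) :
    Lvec c u x 1 ^ 2 + Lvec c u x 2 ^ 2 + Lvec c u x 3 ^ 2 = c x ^ 2 := by
  have h := pd_zero_sq h0 heik
  have hm := invDens_mul_pd (c := c) hp
  rw [Lvec_of_ne_zero (by decide), Lvec_of_ne_zero (by decide), Lvec_of_ne_zero (by decide)]
  have hc2 : c x ^ 2 ≠ 0 := pow_ne_zero 2 h0
  apply mul_left_cancel₀ hc2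
  linear_combination (-invDens c u x ^ 2) * h + (invDens c u x * pd u 0 x + c x ^ 2) * hm

lemma Tvec_zero (h0 : c x ≠ 0) (hp : pd u 0 x ≠ 0) : Tvec c u x 0 = 0 := by
  simp [Tvec, That, Lvec_zero h0 hp]

lemma Tvec_of_ne_zero {i : Fin 4} (hi : i ≠ 0) :
    Tvec c u x i = -((c x ^ 2)⁻¹ * invDens c u x * Lvec c u x i) := by
  simp [Tvec, That, hi]
  ring

end

/-- Lemma 2.7(1): the null-frame components of the deformation tensor ^{(L)}π. -/
theorem deformation_tensor_of_L
    (U : Set Pt) (hU : IsOpen U) (c u : Pt → ℝ)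
    (hc : ContDiffOn ℝ (⊤ : ℕ∞) c U) (hcpos : ∀ x ∈ U, 0 < c x)
    (hu : ContDiffOn ℝ (⊤ : ℕ∞) u U)
    (heik : ∀ x ∈ U, ∑ α, ∑ β, gInv c α β x * pd u α x * pd u β x = 0)
    (hut : ∀ x ∈ U, 0 < pd u 0 x) :
    ∀ x ∈ U,
      defoL c u (Lvec c u) (Lvec c u) x = 0 ∧
      defoL c u (Lvec c u) (Tvec c u) x = -vApp (Lvec c u) (invDens c u) x ∧
      defoL c u (Lvec c u) (Lbar c u) x = -2 * vApp (Lvec c u) (invDens c u) x ∧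
      defoL c u (Tvec c u) (Tvec c u) x
        = 2 * (c x)⁻¹ * invDens c u x
          * vApp (Lvec c u) (fun y => (c y)⁻¹ * invDens c u y) x ∧
      defoL c u (Lbar c u) (Lbar c u) x
        = 4 * invDens c u x
          * vApp (Lvec c u) (fun y => ((c y) ^ 2)⁻¹ * invDens c u y) x := by
  intro x hx
  have hc0 : ∀ y ∈ U, c y ≠ 0 := fun y hy => (hcpos y hy).ne'
  have hp0 : ∀ y ∈ U, pd u 0 y ≠ 0 := fun y hy => (hut y hy).ne'
  have hux : ContDiffAt ℝ 2 u x := 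
    (hu.contDiffAt (hU.mem_nhds hx)).of_le (WithTop.coe_le_coe.2 (le_top : (2 : ℕ∞) ≤ ⊤))
  have dc : DifferentiableAt ℝ c x :=
    (hc.contDiffAt (hU.mem_nhds hx)).differentiableAt (by simp)
  have dp (α : Fin 4) : DifferentiableAt ℝ (pd u α) x :=
    ((hux.fderiv_right (m := 1) (by norm_num)).differentiableAt (by norm_num)).clm_apply
      (differentiableAt_const _)
  have hcx := hc0 x hx
  have hpx := hp0 x hx
  have dc2 : DifferentiableAt ℝ (fun y => c y ^ 2) x := dc.pow 2
  have dμ : DifferentiableAt ℝ (invDens c u) x :=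
    ((dc2.inv (pow_ne_zero 2 hcx)).mul (dp 0)).inv
      (mul_ne_zero (inv_ne_zero (pow_ne_zero 2 hcx)) hpx)
  have dL {i : Fin 4} (hi : i ≠ 0) : DifferentiableAt ℝ (fun y => Lvec c u y i) x := by
    simp only [Lvec_of_ne_zero hi]
    exact (dμ.mul (dp i)).neg
  have hL0 (α : Fin 4) : pd (fun y => Lvec c u y 0) α x = 0 := by
    rw [pd_congr_of_eqOn hU hx (fun y hy => Lvec_zero (hc0 y hy) (hp0 y hy)), pd_const]
  have d1 := dL (i := 1) (by decide)
  have d2 := dL (i := 2) (by decide)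
  have d3 := dL (i := 3) (by decide)
  have hLL (α : Fin 4) : Lvec c u x 1 * pd (fun y => Lvec c u y 1) α x +
      Lvec c u x 2 * pd (fun y => Lvec c u y 2) α x +
      Lvec c u x 3 * pd (fun y => Lvec c u y 3) α x = c x * pd c α x := by
    have h := pd_congr_of_eqOn hU hx
      (fun y hy => sum_Lvec_sq (hc0 y hy) (hp0 y hy) (heik y hy)) α
    rw [pd_sum_three_sq d1 d2 d3, pd_sq dc] at h
    linarith
  have hLp : vApp (Lvec c u) (pd u 0) x * c x = pd u 0 x * pd c 0 x := by
    have h := pd_congr_of_eqOn hU hx (fun y hy => pd_zero_sq (hc0 y hy) (heik y hy)) 0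
    have ds : DifferentiableAt ℝ (fun y => pd u 1 y ^ 2 + pd u 2 y ^ 2 + pd u 3 y ^ 2) x :=
      (((dp 1).pow 2).add ((dp 2).pow 2)).add ((dp 3).pow 2)
    rw [pd_sq (dp 0), pd_mul dc2 ds, pd_sum_three_sq (dp 1) (dp 2) (dp 3), pd_sq dc,
      pd_pd_comm hux 1, pd_pd_comm hux 2, pd_pd_comm hux 3] at h
    have hm := invDens_mul_pd (c := c) hpx
    have he := pd_zero_sq hcx (heik x hx)
    simp only [vApp, Fin.sum_univ_four, Lvec_zero hcx hpx]
    rw [Lvec_of_ne_zero (by decide), Lvec_of_ne_zero (by decide), Lvec_of_ne_zero (by decide)]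
    apply mul_left_cancel₀ hpx
    linear_combination (c x / 2) * h - pd c 0 x * he - c x * (pd u 1 x * pd (pd u 0) 1 x +
      pd u 2 x * pd (pd u 0) 2 x + pd u 3 x * pd (pd u 0) 3 x) * hm
  have hLμ : vApp (Lvec c u) (invDens c u) x * c x =
      invDens c u x * (2 * vApp (Lvec c u) c x - pd c 0 x) := by
    have h (α : Fin 4) :=
      pd_congr_of_eqOn hU hx (fun y hy => invDens_mul_pd (c := c) (hp0 y hy)) α
    have h' : vApp (Lvec c u) (fun y => invDens c u y * pd u 0 y) x =
        vApp (Lvec c u) (fun y => c y ^ 2) x := by simp only [vApp, h]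
    rw [vApp_mul _ dμ (dp 0), vApp_sq _ dc] at h'
    have hm := invDens_mul_pd (c := c) hpx
    apply mul_left_cancel₀ hpx
    linear_combination c x * h' - invDens c u x * hLp - 2 * vApp (Lvec c u) c x * hm
  have hμ' := eq_div_of_mul_eq hcx hLμ
  have hic : DifferentiableAt ℝ (fun y => (c y)⁻¹) x := dc.inv hcx
  have hic2 : DifferentiableAt ℝ (fun y => (c y ^ 2)⁻¹) x := dc2.inv (pow_ne_zero 2 hcx)
  have hπ (X Y : Pt → Fin 4 → ℝ) (a b a' b' : ℝ) (hX0 : X x 0 = a)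
      (hX : ∀ i ≠ 0, X x i = b * Lvec c u x i) (hY0 : Y x 0 = a')
      (hY : ∀ i ≠ 0, Y x i = b' * Lvec c u x i) :
      defoL c u X Y x = c x * (b' * (a * pd c 0 x + b * (vApp (Lvec c u) c x - pd c 0 x)) +
        b * (a' * pd c 0 x + b' * (vApp (Lvec c u) c x - pd c 0 x)) -
        2 * a * a' * vApp (Lvec c u) c x) := by
    rw [defoL_eq u dc hcx]
    have k0 := hLL 0
    have k1 := hLL 1
    have k2 := hLL 2
    have k3 := hLL 3
    simp only [gPair, vApp, Fin.sum_univ_four, hX0, hY0, hX 1 (by decide), hX 2 (by decide),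
      hX 3 (by decide), hY 1 (by decide), hY 2 (by decide), hY 3 (by decide), hL0,
      Lvec_zero hcx hpx]
    simp [gMat, Fin.ext_iff]
    linear_combination (a * b' + a' * b) * k0 + 2 * b * b' * (Lvec c u x 1 * k1 +
      Lvec c u x 2 * k2 + Lvec c u x 3 * k3)
  have hL : ∀ i ≠ 0, Lvec c u x i = 1 * Lvec c u x i := fun i _ => (one_mul _).symm
  have hT : ∀ i ≠ 0, Tvec c u x i = -((c x ^ 2)⁻¹ * invDens c u x) * Lvec c u x i :=
    fun i hi => by rw [Tvec_of_ne_zero hi]; ring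
  have hB0 : Lbar c u x 0 = (c x ^ 2)⁻¹ * invDens c u x := by
    simp [Lbar, Lvec_zero hcx hpx, Tvec_zero hcx hpx]
  have hB : ∀ i ≠ 0, Lbar c u x i = -((c x ^ 2)⁻¹ * invDens c u x) * Lvec c u x i :=
    fun i hi => by rw [Lbar, Tvec_of_ne_zero hi]; ring
  have hL1 := Lvec_zero hcx hpx
  have hT0 := Tvec_zero hcx hpx
  rw [hπ _ _ _ _ _ _ hL1 hL hL1 hL, hπ _ _ _ _ _ _ hL1 hL hT0 hT,
    hπ _ _ _ _ _ _ hL1 hL hB0 hB, hπ _ _ _ _ _ _ hT0 hT hT0 hT, hπ _ _ _ _ _ _ hB0 hB hB0 hB,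
    vApp_mul _ hic dμ, vApp_mul _ hic2 dμ, vApp_inv _ dc hcx,
    vApp_inv _ dc2 (pow_ne_zero 2 hcx), vApp_sq _ dc, hμ']
  refine ⟨?_, ?_, ?_, ?_, ?_⟩ <;> field_simp <;> ring
end
end

section
/- Let p ∈ ℕ with p ≥ 1 and ε₀ ∈ (0,1). Let φ₀ ∈ C₀^∞((−1,0)×S²) and define φ₁(s,ω) := −∂_sφ₀(s,ω) − φ₀(s,ω)·δ − (1/(2(p+1)))·(−∂_sφ₀(s,ω))^{p+1}·δ^{(1−ε₀)p}. For δ ∈ (0,1) define the initial data φ(1,x) := δ^{2−ε₀}φ₀((r−1)/δ, x/r) and ∂_tφ(1,x) := δ^{1−ε₀}φ₁((r−1)/δ, x/r) for x ∈ ℝ³∖{0}, r = |x| (extended by zero outside 1−δ < r < 1), and define ∂_t²φ(1,x) := (1 + (∂_tφ(1,x))^p)^{−1}·Δφ(1,x), as dictated by the equation −(1+(∂_tφ)^p)∂_t²φ + Δφ = 0. Then there exist δ₀ ∈ (0,1) and a constant C > 0, both depending only on φ₀, p, ε₀, such that for all δ ∈ (0,δ₀) and all x ∈ ℝ³∖{0}: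 |(∂_t + ∂_r)²φ(1,x)| = |∂_t²φ(1,x) + 2∂_r∂_tφ(1,x) + ∂_r²φ(1,x)| ≤ C·δ^{2−ε₀−2·max{0, 1−(1−ε₀)p}}. -/
noncomputable section

open scoped BigOperators

attribute [local instance] Classical.propDecidable

/-- Points ω of ℝ³ (with the Euclidean norm). -/
abbrev Sp : Type := EuclideanSpace ℝ (Fin 3)

/-- Points (s, ω) ∈ ℝ × ℝ³ (the sphere variable ω is evaluated on ‖ω‖ = 1). -/
abbrev Spt : Type := ℝ × Sp

/-- The derivative ∂_s in the first argument. -/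
def pds (f : Spt → ℝ) (q : Spt) : ℝ := fderiv ℝ f q (1, 0)

/-- The choice (A.1) of φ₁:
φ₁ = −∂_sφ₀ − φ₀·δ − (1/(2(p+1)))·(−∂_sφ₀)^{p+1}·δ^{(1−ε₀)p}. -/
def phi1 (p : ℕ) (ε₀ : ℝ) (φ₀ : Spt → ℝ) (δ : ℝ) (q : Spt) : ℝ :=
  -pds φ₀ q - φ₀ q * δ
    - (1 / (2 * ((p : ℝ) + 1))) * (-pds φ₀ q) ^ (p + 1) * δ ^ ((1 - ε₀) * p)

/-- Spatial partial derivative ∂_i f on ℝ³. -/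
def pd3 (f : Sp → ℝ) (i : Fin 3) (x : Sp) : ℝ :=
  fderiv ℝ f x (EuclideanSpace.single i 1)

/-- The Laplacian Δf = ∑ᵢ ∂_i²f on ℝ³. -/
def lap3 (f : Sp → ℝ) (x : Sp) : ℝ := ∑ i, pd3 (fun y => pd3 f i y) i x

/-- The radial derivative ∂_r f = (xⁱ/r)∂_i f on ℝ³. -/
def dr3 (f : Sp → ℝ) (x : Sp) : ℝ := fderiv ℝ f x (‖x‖⁻¹ • x)

/-- The short pulse datum φ(1,·), extended by zero outside the annulus. -/
def data0 (ε₀ : ℝ) (φ₀ : Spt → ℝ) (δ : ℝ) (x : Sp) : ℝ :=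
  if x = 0 then 0 else δ ^ (2 - ε₀) * φ₀ ((‖x‖ - 1) / δ, ‖x‖⁻¹ • x)

/-- The short pulse datum ∂_tφ(1,·) with φ₁ given by (A.1), extended by zero. -/
def data1 (p : ℕ) (ε₀ : ℝ) (φ₀ : Spt → ℝ) (δ : ℝ) (x : Sp) : ℝ :=
  if x = 0 then 0 else δ ^ (1 - ε₀) * phi1 p ε₀ φ₀ δ ((‖x‖ - 1) / δ, ‖x‖⁻¹ • x)

section RadialCalculus

open scoped ContDiff Topology RealInnerProductSpace

theorem contDiff_pds {f : Spt → ℝ} (hf : ContDiff ℝ ∞ f) : ContDiff ℝ ∞ (pds f) :=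
  (hf.fderiv_right (m := ∞) le_rfl).clm_apply contDiff_const

theorem contDiff_phi1 {p : ℕ} {ε₀ δ : ℝ} {f : Spt → ℝ} (hf : ContDiff ℝ ∞ f) :
    ContDiff ℝ ∞ (phi1 p ε₀ f δ) := by
  have h := contDiff_pds hf
  unfold phi1
  fun_prop

theorem hasFDerivAt_norm_of_ne_zero {x : Sp} (hx : x ≠ 0) :
    HasFDerivAt (fun y : Sp => ‖y‖) (‖x‖⁻¹ • innerSL ℝ x) x := by
  have h := (hasStrictFDerivAt_norm_sq x).hasFDerivAt.sqrt (by simpa using hx)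
  simp only [Real.sqrt_sq (norm_nonneg _)] at h
  refine h.congr_fderiv ?_
  ext v
  simp
  field_simp

/-- The rescaled coordinates `((‖x‖ - 1) / δ, x)`. -/
def stretch (δ : ℝ) (x : Sp) : Spt := ((‖x‖ - 1) / δ, x)

/-- The extension of `f` from `ℝ × S²` that is homogeneous of degree zero in the second
argument. -/
def homog (f : Spt → ℝ) (q : Spt) : ℝ := f (q.1, ‖q.2‖⁻¹ • q.2)

/-- The partial derivative in the `i`-th coordinate of the second argument. -/
def pdω (f : Spt → ℝ) (i : Fin 3) (q : Spt) : ℝ :=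
  fderiv ℝ f q (0, EuclideanSpace.single i 1)

theorem contDiffAt_homog {f : Spt → ℝ} (hf : ContDiff ℝ ∞ f) {q : Spt} (hq : q.2 ≠ 0) :
    ContDiffAt ℝ ∞ (homog f) q := by
  have hn : ContDiffAt ℝ ∞ (fun q : Spt => ‖q.2‖) q :=
    (contDiffAt_norm ℝ hq).comp q contDiffAt_snd
  exact hf.contDiffAt.comp q
    (contDiffAt_fst.prodMk ((hn.inv (by simpa using hq)).smul contDiffAt_snd))

theorem contDiffAt_pds {f : Spt → ℝ} {q : Spt} (hf : ContDiffAt ℝ ∞ f q) :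
    ContDiffAt ℝ ∞ (pds f) q :=
  (hf.fderiv_right (m := ∞) le_rfl).clm_apply contDiffAt_const

theorem contDiffAt_pdω {f : Spt → ℝ} {q : Spt} (hf : ContDiffAt ℝ ∞ f q) (i : Fin 3) :
    ContDiffAt ℝ ∞ (pdω f i) q :=
  (hf.fderiv_right (m := ∞) le_rfl).clm_apply contDiffAt_const

theorem hasDerivAt_fst_line {F : Spt → ℝ} {s : ℝ} {y : Sp} (hF : DifferentiableAt ℝ F (s, y)) :
    HasDerivAt (fun t => F (t, y)) (pds F (s, y)) s :=
  hF.hasFDerivAt.comp_hasDerivAt s ((hasDerivAt_id s).prodMk (hasDerivAt_const s y))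

theorem hasDerivAt_snd_line {F : Spt → ℝ} {s : ℝ} {y : Sp} (v : Sp)
    (hF : DifferentiableAt ℝ F (s, y)) :
    HasDerivAt (fun t : ℝ => F (s, y + t • v)) (fderiv ℝ F (s, y) (0, v)) 0 := by
  have hg : HasDerivAt (fun t : ℝ => ((s, y + t • v) : Spt)) (0, v) 0 := by
    simpa using (hasDerivAt_const (0 : ℝ) s).prodMk
      (((hasDerivAt_id (0 : ℝ)).smul_const v).const_add y)
  exact HasFDerivAt.comp_hasDerivAt (0 : ℝ) (f := fun t : ℝ => ((s, y + t • v) : Spt))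
    (by simpa using hF.hasFDerivAt) hg

theorem homog_smul (f : Spt → ℝ) (s : ℝ) (y : Sp) {c : ℝ} (hc : 0 < c) :
    homog f (s, c • y) = homog f (s, y) := by
  simp only [homog, norm_smul, Real.norm_eq_abs, abs_of_pos hc, smul_smul]
  congr 3
  field_simp

theorem pds_homog {f : Spt → ℝ} (hf : ContDiff ℝ ∞ f) {q : Spt} (hq : q.2 ≠ 0) :
    pds (homog f) q = homog (pds f) q := by
  obtain ⟨s, y⟩ := q
  exact (hasDerivAt_fst_line ((contDiffAt_homog hf hq).differentiableAt (by simp))).unique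
    (hasDerivAt_fst_line (s := s) (y := ‖y‖⁻¹ • y) (hf.differentiable (by simp) _))

theorem fderiv_homog_radial {f : Spt → ℝ} (hf : ContDiff ℝ ∞ f) {s : ℝ} {y : Sp} (hy : y ≠ 0) :
    fderiv ℝ (homog f) (s, y) (0, y) = 0 := by
  have h := hasDerivAt_snd_line y
    ((contDiffAt_homog hf (q := (s, y)) hy).differentiableAt (by simp))
  refine h.unique ((hasDerivAt_const (0 : ℝ) (homog f (s, y))).congr_of_eventuallyEq ?_)
  filter_upwards [Ioi_mem_nhds (show (-1 : ℝ) < 0 by norm_num)] with t ht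
  rw [show y + t • y = (1 + t) • y by rw [add_smul, one_smul],
    homog_smul f s y (by linarith [Set.mem_Ioi.1 ht])]

theorem sum_coord_mul_pdω (F : Spt → ℝ) (s : ℝ) (y : Sp) :
    ∑ i, y i * pdω F i (s, y) = fderiv ℝ F (s, y) (0, y) := by
  have hy : ((0, y) : Spt) = ∑ i, y i • ((0, EuclideanSpace.single i 1) : Spt) := by
    ext j
    · simp [Fin.sum_univ_three]
    · fin_cases j <;> simp [Fin.sum_univ_three]
  conv_rhs => rw [hy, map_sum]
  simp only [map_smul, smul_eq_mul, pdω]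

theorem hasFDerivAt_stretch (δ : ℝ) {x : Sp} (hx : x ≠ 0) :
    HasFDerivAt (stretch δ)
      ((δ⁻¹ • ‖x‖⁻¹ • innerSL ℝ x).prod (ContinuousLinearMap.id ℝ Sp)) x := by
  refine HasFDerivAt.prodMk ?_ (hasFDerivAt_id x)
  simp only [div_eq_inv_mul]
  exact ((hasFDerivAt_norm_of_ne_zero hx).sub_const 1).const_mul δ⁻¹

theorem fderiv_comp_stretch {F : Spt → ℝ} {δ : ℝ} {x : Sp} (hx : x ≠ 0)
    (hF : DifferentiableAt ℝ F (stretch δ x)) (v : Sp) :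
    fderiv ℝ (fun y => F (stretch δ y)) x v =
      δ⁻¹ * (‖x‖⁻¹ * ⟪x, v⟫) * pds F (stretch δ x) + fderiv ℝ F (stretch δ x) (0, v) := by
  have h := (hF.hasFDerivAt.comp x (hasFDerivAt_stretch δ hx)).fderiv
  change fderiv ℝ (F ∘ stretch δ) x v = _
  rw [h]
  have hv : ((δ⁻¹ * (‖x‖⁻¹ * ⟪x, v⟫), v) : Spt) =
      (δ⁻¹ * (‖x‖⁻¹ * ⟪x, v⟫)) • ((1, 0) : Spt) + (0, v) := by
    ext <;> simp
  simp only [ContinuousLinearMap.comp_apply, ContinuousLinearMap.prod_apply,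
    smul_apply, innerSL_apply_apply, smul_eq_mul,
    ContinuousLinearMap.id_apply]
  rw [hv, map_add, map_smul, smul_eq_mul, pds]

theorem dr3_homog_comp_stretch {f : Spt → ℝ} (hf : ContDiff ℝ ∞ f) (δ : ℝ) {x : Sp}
    (hx : x ≠ 0) :
    dr3 (fun y => homog f (stretch δ y)) x = δ⁻¹ * homog (pds f) (stretch δ x) := by
  have hd := (contDiffAt_homog hf (q := stretch δ x) hx).differentiableAt (by simp)
  have h0 : ((0, ‖x‖⁻¹ • x) : Spt) = ‖x‖⁻¹ • ((0, x) : Spt) := by simp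
  have hr : ‖x‖ ≠ 0 := norm_ne_zero_iff.2 hx
  rw [dr3, fderiv_comp_stretch hx hd, pds_homog hf hx, h0, map_smul, stretch,
    fderiv_homog_radial hf hx, inner_smul_right, real_inner_self_eq_norm_sq]
  simp only [smul_zero, add_zero]
  field_simp

theorem pd3_comp_stretch {F : Spt → ℝ} {δ : ℝ} {x : Sp} (hx : x ≠ 0)
    (hF : DifferentiableAt ℝ F (stretch δ x)) (i : Fin 3) :
    pd3 (fun y => F (stretch δ y)) i x =
      δ⁻¹ * (‖x‖⁻¹ * x i) * pds F (stretch δ x) + pdω F i (stretch δ x) := by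
  rw [pd3, fderiv_comp_stretch hx hF, pdω]
  simp [EuclideanSpace.inner_single_right]

theorem fderiv_coord_div_norm {x : Sp} (hx : x ≠ 0) (i : Fin 3) :
    fderiv ℝ (fun y : Sp => ‖y‖⁻¹ * y i) x (EuclideanSpace.single i 1) =
      ‖x‖⁻¹ - x i ^ 2 * ‖x‖⁻¹ ^ 3 ∧ DifferentiableAt ℝ (fun y : Sp => ‖y‖⁻¹ * y i) x := by
  have hr : ‖x‖ ≠ 0 := norm_ne_zero_iff.2 hx
  have h1 := (hasDerivAt_inv hr).comp_hasFDerivAt x (hasFDerivAt_norm_of_ne_zero hx)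
  have h2 : HasFDerivAt (fun y : Sp => y i) (EuclideanSpace.proj i : Sp →L[ℝ] ℝ) x :=
    (EuclideanSpace.proj i : Sp →L[ℝ] ℝ).hasFDerivAt
  have h3 := h1.mul h2
  refine ⟨?_, h3.differentiableAt⟩
  have h4 := congrArg (fun L => L (EuclideanSpace.single i 1)) h3.fderiv
  refine h4.trans ?_
  simp [EuclideanSpace.inner_single_right]
  field_simp
  ring

theorem lap3_homog_comp_stretch {f : Spt → ℝ} (hf : ContDiff ℝ ∞ f) (δ : ℝ) {x : Sp}
    (hx : x ≠ 0) :
    lap3 (fun y => homog f (stretch δ y)) x =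
      δ⁻¹ ^ 2 * homog (pds (pds f)) (stretch δ x)
        + 2 * ‖x‖⁻¹ * δ⁻¹ * homog (pds f) (stretch δ x)
        + ∑ i, pdω (pdω (homog f) i) i (stretch δ x) := by
  have hr : ‖x‖ ≠ 0 := norm_ne_zero_iff.2 hx
  have hB := contDiff_pds hf
  have hne : ∀ᶠ y in 𝓝 x, y ≠ 0 := isOpen_ne.mem_nhds hx
  have hA : ∀ i, DifferentiableAt ℝ (pdω (homog f) i) (stretch δ x) := fun i =>
    (contDiffAt_pdω (contDiffAt_homog hf (q := stretch δ x) hx) i).differentiableAt (by simp)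
  have hBd : DifferentiableAt ℝ (homog (pds f)) (stretch δ x) :=
    (contDiffAt_homog hB (q := stretch δ x) hx).differentiableAt (by simp)
  have hst : DifferentiableAt ℝ (stretch δ) x := (hasFDerivAt_stretch δ hx).differentiableAt
  have key : ∀ i, pd3 (fun y => pd3 (fun y => homog f (stretch δ y)) i y) i x =
      δ⁻¹ * (‖x‖⁻¹ - x i ^ 2 * ‖x‖⁻¹ ^ 3) * homog (pds f) (stretch δ x)
        + δ⁻¹ * (‖x‖⁻¹ * x i) * (δ⁻¹ * (‖x‖⁻¹ * x i) * homog (pds (pds f)) (stretch δ x)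
          + pdω (homog (pds f)) i (stretch δ x))
        + (δ⁻¹ * (‖x‖⁻¹ * x i) * pds (pdω (homog f) i) (stretch δ x)
          + pdω (pdω (homog f) i) i (stretch δ x)) := by
    intro i
    obtain ⟨hc, hcd⟩ := fderiv_coord_div_norm hx i
    have e1 : (fun y => pd3 (fun y => homog f (stretch δ y)) i y) =ᶠ[𝓝 x] fun y =>
        δ⁻¹ * ((‖y‖⁻¹ * y i) * homog (pds f) (stretch δ y)) + pdω (homog f) i (stretch δ y) := by
      filter_upwards [hne] with y hy
      rw [pd3_comp_stretch hy
        ((contDiffAt_homog hf (q := stretch δ y) hy).differentiableAt (by simp)),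
        pds_homog hf (q := stretch δ y) hy]
      ring
    have hBc : DifferentiableAt ℝ (fun y => homog (pds f) (stretch δ y)) x := hBd.comp x hst
    have hAc : DifferentiableAt ℝ (fun y => pdω (homog f) i (stretch δ y)) x := (hA i).comp x hst
    have hP := pd3_comp_stretch hx hBd i
    have hQ := pd3_comp_stretch hx (hA i) i
    rw [pds_homog hB (q := stretch δ x) hx] at hP
    rw [← hP, ← hQ]
    unfold pd3 at e1 ⊢
    rw [e1.fderiv_eq, fderiv_fun_add ((hcd.fun_mul hBc).const_mul _) hAc,
      fderiv_const_mul (hcd.fun_mul hBc), fderiv_fun_mul hcd hBc, ← hc]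
    simp
    ring
  have hE1 : ∑ i, x i * pdω (homog (pds f)) i (stretch δ x) = 0 := by
    rw [stretch, sum_coord_mul_pdω, fderiv_homog_radial hB hx]
  have hE2 : ∑ i, x i * pds (pdω (homog f) i) (stretch δ x) = 0 := by
    have hs : HasDerivAt (fun t => ∑ i, x i * pdω (homog f) i (t, x))
        (∑ i, x i * pds (pdω (homog f) i) (stretch δ x)) ((‖x‖ - 1) / δ) :=
      HasDerivAt.fun_sum fun i _ => (hasDerivAt_fst_line (hA i)).const_mul (x i)
    simp only [sum_coord_mul_pdω, fderiv_homog_radial hf hx] at hs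
    exact hs.unique (hasDerivAt_const _ _)
  have hN : ∑ i, x i ^ 2 = ‖x‖ ^ 2 := by
    simp [EuclideanSpace.norm_sq_eq]
  simp only [lap3, key, Fin.sum_univ_three] at hE1 hE2 hN ⊢
  have hN' : ‖x‖⁻¹ ^ 2 * (x 0 ^ 2 + x 1 ^ 2 + x 2 ^ 2) = 1 := by rw [hN]; field_simp
  linear_combination (δ⁻¹ * ‖x‖⁻¹) * hE1 + (δ⁻¹ * ‖x‖⁻¹) * hE2
    + (δ⁻¹ ^ 2 * homog (pds (pds f)) (stretch δ x)
      - δ⁻¹ * ‖x‖⁻¹ * homog (pds f) (stretch δ x)) * hN'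

end RadialCalculus

section ShortPulseData

open scoped ContDiff Topology

variable {p : ℕ} {ε₀ δ : ℝ} {f : Spt → ℝ} {x : Sp}

theorem pds_phi1 (hf : ContDiff ℝ ∞ f) (q : Spt) :
    pds (phi1 p ε₀ f δ) q = -pds (pds f) q - pds f q * δ
      + 1 / 2 * (-pds f q) ^ p * pds (pds f) q * δ ^ ((1 - ε₀) * p) := by
  obtain ⟨s, y⟩ := q
  have h0 := hasDerivAt_fst_line (s := s) (y := y) (hf.differentiable (by simp) _)
  have h1 := hasDerivAt_fst_line (s := s) (y := y) ((contDiff_pds hf).differentiable (by simp) _)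
  have h := hasDerivAt_fst_line (s := s) (y := y)
    ((contDiff_phi1 (p := p) (ε₀ := ε₀) (δ := δ) hf).differentiable (by simp) _)
  refine h.unique ((((h1.neg).sub (h0.mul_const δ)).sub
    (((h1.neg.pow (p + 1)).const_mul (1 / (2 * ((p : ℝ) + 1)))).mul_const _)).congr_deriv ?_)
  have hp : (p : ℝ) + 1 ≠ 0 := by positivity
  simp [-mul_eq_mul_right_iff, -mul_eq_mul_left_iff]
  field_simp

theorem pd3_const_mul (c : ℝ) (g : Sp → ℝ) (i : Fin 3) (x : Sp) :
    pd3 (fun y => c * g y) i x = c * pd3 g i x := by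
  have h := fderiv_const_smul_field (𝕜 := ℝ) c (f := g)
  exact congrArg (fun L => L x (EuclideanSpace.single i 1)) h

theorem dr3_const_mul (c : ℝ) (g : Sp → ℝ) (x : Sp) :
    dr3 (fun y => c * g y) x = c * dr3 g x := by
  have h := fderiv_const_smul_field (𝕜 := ℝ) c (f := g)
  exact congrArg (fun L => L x (‖x‖⁻¹ • x)) h

theorem lap3_const_mul (c : ℝ) (g : Sp → ℝ) (x : Sp) :
    lap3 (fun y => c * g y) x = c * lap3 g x := by
  simp only [lap3, pd3_const_mul, Finset.mul_sum]

theorem Filter.EventuallyEq.dr3_eq {g h : Sp → ℝ} (e : g =ᶠ[𝓝 x] h) : dr3 g x = dr3 h x := by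
  rw [dr3, e.fderiv_eq, dr3]

theorem Filter.EventuallyEq.lap3_eq {g h : Sp → ℝ} (e : g =ᶠ[𝓝 x] h) : lap3 g x = lap3 h x := by
  refine Finset.sum_congr rfl fun i _ => ?_
  have : (fun y => pd3 g i y) =ᶠ[𝓝 x] fun y => pd3 h i y := by
    filter_upwards [e.eventuallyEq_nhds] with y hy
    rw [pd3, hy.fderiv_eq, pd3]
  rw [pd3, this.fderiv_eq, pd3]

theorem data0_eq (hx : x ≠ 0) :
    data0 ε₀ f δ x = δ ^ (2 - ε₀) * homog f (stretch δ x) := if_neg hx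

theorem data1_eq (hx : x ≠ 0) :
    data1 p ε₀ f δ x = δ ^ (1 - ε₀) * homog (phi1 p ε₀ f δ) (stretch δ x) := if_neg hx

theorem data0_eventuallyEq (hx : x ≠ 0) :
    data0 ε₀ f δ =ᶠ[𝓝 x] fun y => δ ^ (2 - ε₀) * homog f (stretch δ y) := by
  filter_upwards [isOpen_ne.mem_nhds hx] with y hy using data0_eq hy

theorem data1_eventuallyEq (hx : x ≠ 0) :
    data1 p ε₀ f δ =ᶠ[𝓝 x] fun y => δ ^ (1 - ε₀) * homog (phi1 p ε₀ f δ) (stretch δ y) := by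
  filter_upwards [isOpen_ne.mem_nhds hx] with y hy using data1_eq hy

theorem lap3_data0 (hf : ContDiff ℝ ∞ f) (hx : x ≠ 0) :
    lap3 (data0 ε₀ f δ) x = δ ^ (2 - ε₀) * (δ⁻¹ ^ 2 * homog (pds (pds f)) (stretch δ x)
        + 2 * ‖x‖⁻¹ * δ⁻¹ * homog (pds f) (stretch δ x)
        + ∑ i, pdω (pdω (homog f) i) i (stretch δ x)) := by
  rw [(data0_eventuallyEq hx).lap3_eq, lap3_const_mul, lap3_homog_comp_stretch hf δ hx]

theorem dr3_data0 (hf : ContDiff ℝ ∞ f) (hx : x ≠ 0) :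
    dr3 (data0 ε₀ f δ) x = δ ^ (2 - ε₀) * (δ⁻¹ * homog (pds f) (stretch δ x)) := by
  rw [(data0_eventuallyEq hx).dr3_eq, dr3_const_mul, dr3_homog_comp_stretch hf δ hx]

theorem dr3_dr3_data0 (hf : ContDiff ℝ ∞ f) (hx : x ≠ 0) :
    dr3 (fun y => dr3 (data0 ε₀ f δ) y) x =
      δ ^ (2 - ε₀) * (δ⁻¹ * (δ⁻¹ * homog (pds (pds f)) (stretch δ x))) := by
  have e : (fun y => dr3 (data0 ε₀ f δ) y) =ᶠ[𝓝 x]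
      fun y => δ ^ (2 - ε₀) * (δ⁻¹ * homog (pds f) (stretch δ y)) := by
    filter_upwards [isOpen_ne.mem_nhds hx] with y hy using dr3_data0 hf hy
  rw [e.dr3_eq, dr3_const_mul, dr3_const_mul, dr3_homog_comp_stretch (contDiff_pds hf) δ hx]

theorem dr3_data1 (hf : ContDiff ℝ ∞ f) (hx : x ≠ 0) :
    dr3 (data1 p ε₀ f δ) x =
      δ ^ (1 - ε₀) * (δ⁻¹ * homog (pds (phi1 p ε₀ f δ)) (stretch δ x)) := by
  rw [(data1_eventuallyEq hx).dr3_eq, dr3_const_mul,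
    dr3_homog_comp_stretch (contDiff_phi1 hf) δ hx]

/-- The exact form of `(∂_t + ∂_r)²φ(1,x)` after the chain rule, with the factor `δ^{-ε₀}`
taken out. -/
theorem outgoing_eq (hf : ContDiff ℝ ∞ f) (hx : x ≠ 0) (hδ : 0 < δ)
    {a u v w : ℝ} (ha : homog f (stretch δ x) = a)
    (hu : homog (pds f) (stretch δ x) = u) (hv : homog (pds (pds f)) (stretch δ x) = v)
    (hw : -u - a * δ - 1 / (2 * ((p : ℝ) + 1)) * (-u) ^ (p + 1) * δ ^ ((1 - ε₀) * p) = w) :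
    (1 + (data1 p ε₀ f δ x) ^ p)⁻¹ * lap3 (data0 ε₀ f δ) x
        + 2 * dr3 (data1 p ε₀ f δ) x + dr3 (fun y => dr3 (data0 ε₀ f δ) y) x =
      δ ^ (-ε₀) * ((1 + δ ^ ((1 - ε₀) * p) * w ^ p)⁻¹ * (v + 2 * ‖x‖⁻¹ * δ * u
          + δ ^ 2 * ∑ i, pdω (pdω (homog f) i) i (stretch δ x))
        + 2 * (-v - u * δ + 1 / 2 * (-u) ^ p * v * δ ^ ((1 - ε₀) * p)) + v) := by
  have h1 : δ ^ (1 - ε₀) = δ ^ (-ε₀) * δ := by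
    rw [show 1 - ε₀ = -ε₀ + 1 by ring, Real.rpow_add_one hδ.ne']
  have h2 : δ ^ (2 - ε₀) = δ ^ (-ε₀) * δ ^ 2 := by
    rw [show 2 - ε₀ = -ε₀ + (2 : ℕ) by push_cast; ring, Real.rpow_add_natCast hδ.ne']
  have hw' : homog (phi1 p ε₀ f δ) (stretch δ x) = w := by rw [← hw, ← ha, ← hu]; rfl
  have hd : homog (pds (phi1 p ε₀ f δ)) (stretch δ x) =
      -v - u * δ + 1 / 2 * (-u) ^ p * v * δ ^ ((1 - ε₀) * p) := by
    rw [← hu, ← hv]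
    exact pds_phi1 hf _
  rw [lap3_data0 hf hx, dr3_dr3_data0 hf hx, dr3_data1 hf hx, data1_eq hx, hw', hd, hu, hv,
    mul_pow, ← Real.rpow_mul_natCast hδ.le, h1, h2]
  field_simp

theorem outgoing_cancellation (p : ℕ) {M : ℝ} (hM : 1 ≤ M) :
    ∃ K ≥ 1, ∃ C > 0, ∀ a u v L s r δ D η w : ℝ, |a| ≤ M → |u| ≤ M → |v| ≤ M → |L| ≤ M →
      |s| ≤ 1 → 0 < δ → δ ≤ 1 / 2 → r = 1 + δ * s → 0 ≤ D → D * K ≤ 1 / 2 → δ ≤ η → D ≤ η →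
      -u - a * δ - 1 / (2 * ((p : ℝ) + 1)) * (-u) ^ (p + 1) * D = w →
      |(1 + D * w ^ p)⁻¹ * (v + 2 * r⁻¹ * δ * u + δ ^ 2 * L)
        + 2 * (-v - u * δ + 1 / 2 * (-u) ^ p * v * D) + v| ≤ C * η ^ 2 := by
  set B := 3 * M ^ (p + 1) with hB
  have hMp : M ≤ M ^ (p + 1) := le_self_pow₀ hM (by omega)
  have hB1 : 1 ≤ B := by linarith
  have hK1 : 1 ≤ B ^ p := one_le_pow₀ hB1
  set K := B ^ p with hK
  refine ⟨K, hK1, M * (2 * K ^ 2) + M * (2 * B * p * B ^ (p - 1)) + 2 * M * (4 * K + 2) + 2 * M,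
    by positivity, ?_⟩
  intro a u v L s r δ D η w ha hu hv hL hs hδ hδ2 hr hD hDK hδη hDη hw
  have hη : 0 ≤ η := hδ.le.trans hδη
  have hD1 : D ≤ 1 / 2 := by nlinarith
  have hc : |1 / (2 * ((p : ℝ) + 1))| ≤ 1 := by
    rw [abs_of_pos (by positivity), div_le_one (by positivity)]
    nlinarith [(Nat.cast_nonneg p : (0 : ℝ) ≤ p)]
  have hup : |(-u) ^ (p + 1)| ≤ M ^ (p + 1) := by
    rw [abs_pow, abs_neg]
    gcongr
  have hcu : |1 / (2 * ((p : ℝ) + 1)) * (-u) ^ (p + 1)| ≤ M ^ (p + 1) := by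
    rw [abs_mul]
    exact (mul_le_mul hc hup (abs_nonneg _) zero_le_one).trans (one_mul _).le
  have hdiff : |w - -u| ≤ B * η := by
    have e : w - -u = -(a * δ + 1 / (2 * ((p : ℝ) + 1)) * (-u) ^ (p + 1) * D) := by
      rw [← hw]; ring
    rw [e, abs_neg]
    refine (abs_add_le _ _).trans ?_
    rw [abs_mul, abs_mul _ D, abs_of_pos hδ, abs_of_nonneg hD]
    have h1 : |a| * δ ≤ M * η := by gcongr
    have h2 := mul_le_mul hcu hDη hD (by positivity)
    nlinarith
  have hwB : |w| ≤ B := by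
    have h1 : |w| ≤ |a| * δ + |1 / (2 * ((p : ℝ) + 1)) * (-u) ^ (p + 1)| * D + |u| := by
      rw [← hw, ← abs_of_pos hδ, ← abs_of_nonneg hD, ← abs_mul, ← abs_mul, abs_of_pos hδ,
        abs_of_nonneg hD]
      refine (abs_sub _ _).trans ?_
      have := abs_sub (-u) (a * δ)
      rw [abs_neg] at this
      linarith
    have h2 : |a| * δ ≤ M * 1 := by gcongr; linarith
    have h3 : |1 / (2 * ((p : ℝ) + 1)) * (-u) ^ (p + 1)| * D ≤ M ^ (p + 1) * 1 := by
      gcongr; linarith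
    linarith
  have huB : |(-u)| ≤ B := by rw [abs_neg]; linarith
  have hwK : |w ^ p| ≤ K := by rw [abs_pow, hK]; gcongr
  have hpow : |(-u) ^ p - w ^ p| ≤ B * p * B ^ (p - 1) * η := by
    rw [abs_sub_comm]
    refine (abs_pow_sub_pow_le _ _ _).trans ?_
    have : max |w| |(-u)| ^ (p - 1) ≤ B ^ (p - 1) := by gcongr; exact max_le hwB huB
    calc |w - -u| * p * max |w| |(-u)| ^ (p - 1) ≤ B * η * p * B ^ (p - 1) := by gcongr
      _ = _ := by ring
  have hDw : |D * w ^ p| ≤ 1 / 2 := by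
    rw [abs_mul, abs_of_nonneg hD]
    exact (mul_le_mul_of_nonneg_left hwK hD).trans hDK
  have hpos : 1 / 2 ≤ 1 + D * w ^ p := by linarith [(abs_le.1 hDw).1]
  set e := (1 + D * w ^ p)⁻¹ with he
  have he0 : 0 < e := inv_pos.2 (by linarith)
  have he2 : |e| ≤ 2 := by
    rw [abs_of_pos he0, he]
    exact (inv_anti₀ (by norm_num) hpos).trans (by norm_num)
  have hee : e = 1 - D * w ^ p * e := by
    have : (1 + D * w ^ p) * e = 1 := mul_inv_cancel₀ (by linarith)
    linarith
  have hr2 : 1 / 2 ≤ r := by nlinarith [(abs_le.1 hs).1]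
  have hr0 : r ≠ 0 := by linarith
  have hri : |r⁻¹| ≤ 2 := by
    rw [abs_of_pos (inv_pos.2 (by linarith))]
    exact (inv_anti₀ (by norm_num) hr2).trans (by norm_num)
  have hrr : r⁻¹ = 1 - δ * s * r⁻¹ := by
    have : r * r⁻¹ = 1 := mul_inv_cancel₀ hr0
    rw [hr] at this ⊢
    linarith
  have split : e * (v + 2 * r⁻¹ * δ * u + δ ^ 2 * L)
        + 2 * (-v - u * δ + 1 / 2 * (-u) ^ p * v * D) + v =
      v * (D * D) * (w ^ p * w ^ p) * e + v * D * ((-u) ^ p - w ^ p)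
        + 2 * δ * u * (-(D * w ^ p * e * r⁻¹) - δ * s * r⁻¹) + δ * δ * L * e := by
    have h1 : e - 1 + D * w ^ p = D * D * (w ^ p * w ^ p) * e := by
      linear_combination (1 - D * w ^ p) * hee
    have h2 : e * r⁻¹ - 1 = -(D * w ^ p * e * r⁻¹) - δ * s * r⁻¹ := by
      linear_combination r⁻¹ * hee + hrr
    linear_combination v * h1 + 2 * δ * u * h2
  rw [split]
  have b1 : |v * (D * D) * (w ^ p * w ^ p) * e| ≤ M * (η * η) * (K * K) * 2 := by
    rw [abs_mul, abs_mul, abs_mul, abs_mul (w ^ p), abs_mul D, abs_of_nonneg hD]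
    gcongr
  have b2 : |v * D * ((-u) ^ p - w ^ p)| ≤ M * η * (B * p * B ^ (p - 1) * η) := by
    rw [abs_mul, abs_mul, abs_of_nonneg hD]
    gcongr
  have b3 : |2 * δ * u * (-(D * w ^ p * e * r⁻¹) - δ * s * r⁻¹)| ≤
      2 * η * M * (η * K * 2 * 2 + η * 1 * 2) := by
    have h1 : |(-(D * w ^ p * e * r⁻¹) - δ * s * r⁻¹)| ≤ η * K * 2 * 2 + η * 1 * 2 := by
      refine (abs_sub _ _).trans ?_
      rw [abs_neg, abs_mul, abs_mul, abs_mul, abs_mul, abs_mul, abs_of_nonneg hD, abs_of_pos hδ]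
      gcongr
    rw [abs_mul, abs_mul, abs_mul, abs_of_pos hδ, abs_two]
    gcongr
  have b4 : |δ * δ * L * e| ≤ η * η * M * 2 := by
    rw [abs_mul, abs_mul, abs_mul, abs_of_pos hδ]
    gcongr
  refine (abs_add_le _ _).trans ((add_le_add ((abs_add_le _ _).trans
    (add_le_add ((abs_add_le _ _).trans (add_le_add b1 b2)) b3)) b4).trans ?_)
  have : 0 ≤ M * (B * p * B ^ (p - 1)) * η ^ 2 := by positivity
  linarith

theorem pds_eq_zero_of_notMem_Icc {g : Spt → ℝ}
    (hg : ∀ (s : ℝ) (y : Sp), s ∉ Set.Icc (-1 : ℝ) 0 → g (s, y) = 0)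
    (s : ℝ) (y : Sp) (hs : s ∉ Set.Icc (-1 : ℝ) 0) : pds g (s, y) = 0 := by
  have : g =ᶠ[𝓝 (s, y)] fun _ => (0 : ℝ) := by
    filter_upwards [(isClosed_Icc.isOpen_compl.preimage continuous_fst).mem_nhds hs] with q hq
      using hg q.1 q.2 hq
  rw [pds, this.fderiv_eq]
  simp

theorem pdω_eq_zero_of_notMem_Icc {g : Spt → ℝ}
    (hg : ∀ (s : ℝ) (y : Sp), s ∉ Set.Icc (-1 : ℝ) 0 → g (s, y) = 0)
    (i : Fin 3) (s : ℝ) (y : Sp) (hs : s ∉ Set.Icc (-1 : ℝ) 0) : pdω g i (s, y) = 0 := by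
  have : g =ᶠ[𝓝 (s, y)] fun _ => (0 : ℝ) := by
    filter_upwards [(isClosed_Icc.isOpen_compl.preimage continuous_fst).mem_nhds hs] with q hq
      using hg q.1 q.2 hq
  rw [pdω, this.fderiv_eq]
  simp

theorem exists_bound_homog {g : Spt → ℝ} (hg : Continuous g) :
    ∃ M, ∀ q : Spt, q.1 ∈ Set.Icc (-1 : ℝ) 0 → q.2 ≠ 0 → |homog g q| ≤ M := by
  obtain ⟨M, hM⟩ := (isCompact_Icc (a := (-1 : ℝ)) (b := 0)).prod
    (isCompact_sphere (0 : Sp) 1) |>.exists_bound_of_continuousOn hg.continuousOn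
  refine ⟨M, fun q hq hq2 => hM _ ⟨hq, ?_⟩⟩
  simp [norm_smul, hq2]

theorem exists_bound_sum_pdω (hf : ContDiff ℝ ∞ f) :
    ∃ M, ∀ q : Spt, q.1 ∈ Set.Icc (-1 : ℝ) 0 → 1 / 2 ≤ ‖q.2‖ → ‖q.2‖ ≤ 1 →
      |∑ i, pdω (pdω (homog f) i) i q| ≤ M := by
  have hK : IsCompact (Set.Icc (-1 : ℝ) 0 ×ˢ
      (Metric.closedBall (0 : Sp) 1 \ Metric.ball 0 (1 / 2))) :=
    isCompact_Icc.prod ((isCompact_closedBall _ _).diff Metric.isOpen_ball)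
  obtain ⟨M, hM⟩ := hK.exists_bound_of_continuousOn
    (f := fun q : Spt => ∑ i, pdω (pdω (homog f) i) i q) (by
      intro q hq
      have hq2 : q.2 ≠ 0 := by
        rintro h
        have := hq.2.2
        rw [h] at this
        norm_num at this
      refine ContinuousAt.continuousWithinAt (tendsto_finsetSum _ fun i _ => ?_)
      exact (contDiffAt_pdω (contDiffAt_pdω (contDiffAt_homog hf hq2) i) i).continuousAt)
  exact ⟨M, fun q h1 h2 h3 => hM q ⟨h1, by simpa using h3, by simpa using h2⟩⟩

end ShortPulseData

/-- Appendix A, second-order case (A.2): with the choice (A.1) of φ₁ and with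
∂_t²φ(1,x) := (1+(∂_tφ(1,x))^p)⁻¹Δφ(1,x) as dictated by the equation, the short pulse
data satisfy |(∂_t+∂_r)²φ(1,x)| = |∂_t²φ + 2∂_r∂_tφ + ∂_r²φ|(1,x)
≤ C·δ^{2−ε₀−2max{0,1−(1−ε₀)p}}. -/
theorem outgoing_constraint_second_order
    (p : ℕ) (hp : 1 ≤ p) (ε₀ : ℝ) (hε : ε₀ ∈ Set.Ioo (0 : ℝ) 1)
    (φ₀ : Spt → ℝ) (hφ₀ : ContDiff ℝ (⊤ : ℕ∞) φ₀)
    (hsupp : ∀ (s : ℝ) (ω : Sp), s ∉ Set.Ioo (-1 : ℝ) 0 → φ₀ (s, ω) = 0) :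
    ∃ δ₀ ∈ Set.Ioo (0 : ℝ) 1, ∃ C > (0 : ℝ), ∀ δ ∈ Set.Ioo (0 : ℝ) δ₀, ∀ x : Sp, x ≠ 0 →
      |(1 + (data1 p ε₀ φ₀ δ x) ^ p)⁻¹ * lap3 (data0 ε₀ φ₀ δ) x
          + 2 * dr3 (data1 p ε₀ φ₀ δ) x
          + dr3 (fun y => dr3 (data0 ε₀ φ₀ δ) y) x|
        ≤ C * δ ^ (2 - ε₀ - 2 * max 0 (1 - (1 - ε₀) * p)) := by
  obtain ⟨hε0, hε1⟩ := hε
  have hp0 : (0 : ℝ) < p := by exact_mod_cast hp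
  set κ := (1 - ε₀) * (p : ℝ) with hκ
  have hκ0 : 0 < κ := mul_pos (by linarith) hp0
  have hd1 := contDiff_pds hφ₀
  have hd2 := contDiff_pds hd1
  obtain ⟨Ma, hMa⟩ := exists_bound_homog hφ₀.continuous
  obtain ⟨Mu, hMu⟩ := exists_bound_homog hd1.continuous
  obtain ⟨Mv, hMv⟩ := exists_bound_homog hd2.continuous
  obtain ⟨ML, hML⟩ := exists_bound_sum_pdω hφ₀
  set M := max 1 (max (max Ma Mu) (max Mv ML))
  obtain ⟨K, hK, C, hC, main⟩ := outgoing_cancellation p (le_max_left _ _ : 1 ≤ M)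
  have hK0 : 0 < 1 / (2 * K) := by positivity
  refine ⟨min (1 / 2) ((1 / (2 * K)) ^ κ⁻¹), ⟨by positivity,
    (min_le_left _ _).trans_lt (by norm_num)⟩, C, hC, ?_⟩
  rintro δ ⟨hδ, hδ'⟩ x hx
  have hδ2 : δ ≤ 1 / 2 := (hδ'.trans_le (min_le_left _ _)).le
  have hDK : δ ^ κ * K ≤ 1 / 2 := by
    have h := Real.rpow_le_rpow hδ.le (hδ'.trans_le (min_le_right _ _)).le hκ0.le
    rw [Real.rpow_inv_rpow hK0.le hκ0.ne'] at h
    calc δ ^ κ * K ≤ 1 / (2 * K) * K := by gcongr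
      _ = 1 / 2 := by field_simp
  set m := 1 - max 0 (1 - κ) with hm
  have hexp : δ ^ (2 - ε₀ - 2 * max 0 (1 - κ)) = δ ^ (-ε₀) * (δ ^ m) ^ 2 := by
    rw [← Real.rpow_mul_natCast hδ.le, ← Real.rpow_add hδ, hm]
    congr 1
    push_cast
    ring
  have hδm : δ ≤ δ ^ m := by
    conv_lhs => rw [← Real.rpow_one δ]
    exact Real.rpow_le_rpow_of_exponent_ge hδ (by linarith)
      (by linarith [le_max_left 0 (1 - κ)])
  have hDm : δ ^ κ ≤ δ ^ m := Real.rpow_le_rpow_of_exponent_ge hδ (by linarith)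
    (by linarith [le_max_right 0 (1 - κ)])
  rw [outgoing_eq hφ₀ hx hδ rfl rfl rfl rfl, hexp, abs_mul,
    abs_of_pos (Real.rpow_pos_of_pos hδ _), mul_left_comm]
  refine mul_le_mul_of_nonneg_left ?_ (Real.rpow_pos_of_pos hδ _).le
  by_cases hs : (‖x‖ - 1) / δ ∈ Set.Icc (-1 : ℝ) 0
  · have hr : ‖x‖ = 1 + δ * ((‖x‖ - 1) / δ) := by field_simp; ring
    have hs1 : |(‖x‖ - 1) / δ| ≤ 1 := abs_le.2 ⟨hs.1, hs.2.trans zero_le_one⟩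
    have hx1 : 1 / 2 ≤ ‖x‖ := by nlinarith [hs.1]
    have hx2 : ‖x‖ ≤ 1 := by nlinarith [hs.2]
    refine main _ _ _ _ _ _ _ _ _ _ ((hMa (stretch δ x) hs hx).trans ?_)
      ((hMu (stretch δ x) hs hx).trans ?_) ((hMv (stretch δ x) hs hx).trans ?_)
      ((hML (stretch δ x) hs hx1 hx2).trans ?_) hs1 hδ hδ2 hr (Real.rpow_pos_of_pos hδ _).le
      hDK hδm hDm rfl
    all_goals simp
  · have z0 : ∀ (s : ℝ) (ω : Sp), s ∉ Set.Icc (-1 : ℝ) 0 → φ₀ (s, ω) = 0 := fun s ω h =>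
      hsupp s ω fun h' => h (Set.Ioo_subset_Icc_self h')
    have z1 := pds_eq_zero_of_notMem_Icc z0
    have z2 := pds_eq_zero_of_notMem_Icc z1
    have y0 : ∀ (s : ℝ) (ω : Sp), s ∉ Set.Icc (-1 : ℝ) 0 → homog φ₀ (s, ω) = 0 :=
      fun s ω h => z0 s _ h
    have hL : ∑ i, pdω (pdω (homog φ₀) i) i (stretch δ x) = 0 :=
      Finset.sum_eq_zero fun i _ => pdω_eq_zero_of_notMem_Icc (pdω_eq_zero_of_notMem_Icc y0 i) i _ _ hs
    have hu : homog (pds φ₀) (stretch δ x) = 0 := z1 _ _ hs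
    have hv : homog (pds (pds φ₀)) (stretch δ x) = 0 := z2 _ _ hs
    rw [hL, hu, hv]
    simp
    positivity
end
end
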